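/- For every real number c > 0 there exists R₀ > 0 such that for all R ≥ R₀ and all t > 0 there exists an infinitely differentiable function k : ℝ → ℝ satisfying: (i) k(λ) ≤ 0 for all λ ∈ [0, t²R²], k ≡ 0 on [0, t²R²/4], and there exists δ > 0 with k ≡ 0 on [t²R² − δ, t²R²]; (ii) ∫₀^{t²R²} k(λ) dλ = −t⁴; (iii) k(λ) ≥ −cλ for all λ ∈ [0, t²R²], and there exists λ* ∈ (t²R²/4, t²R²) with k(λ*) = −cλ*. -/

import Mathlib

/-- An even function `φ` has vanishing first moment, so the first moment of its rescaled
translate `x ↦ φ ((x - m) / r)` is `r * m * ∫ φ`. -/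
theorem integral_mul_even_comp_sub_div {φ : ℝ → ℝ} (hφ : Continuous φ)
    (hsupp : HasCompactSupport φ) (heven : ∀ x, φ (-x) = φ x) (m : ℝ) {r : ℝ} (hr : 0 < r) :
    ∫ x, x * φ ((x - m) / r) = r * m * ∫ u, φ u := by
  have hodd : ∫ u, u * φ u = 0 := by
    have h := MeasureTheory.integral_neg_eq_self (fun u : ℝ ↦ u * φ u) MeasureTheory.volume
    simp only [heven, neg_mul, MeasureTheory.integral_neg] at h
    linarith
  have h_int : MeasureTheory.Integrable φ := hφ.integrable_of_hasCompactSupport hsupp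
  have h_int' : MeasureTheory.Integrable (fun u ↦ u * φ u) :=
    (continuous_id.mul hφ).integrable_of_hasCompactSupport hsupp.mul_left
  calc ∫ x, x * φ ((x - m) / r)
      = ∫ x, (fun y ↦ (m + r * (y / r)) * φ (y / r)) (x - m) := by
        congr 1 with x
        have h : r * ((x - m) / r) = x - m := by field_simp
        simp only [h, add_sub_cancel]
    _ = ∫ y, (fun u ↦ (m + r * u) * φ u) (y / r) :=
        MeasureTheory.integral_sub_right_eq_self (fun y ↦ (m + r * (y / r)) * φ (y / r)) m
    _ = r * ∫ u, (m + r * u) * φ u := by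
        rw [MeasureTheory.Measure.integral_comp_div (fun u ↦ (m + r * u) * φ u), abs_of_pos hr,
          smul_eq_mul]
    _ = r * m * ∫ u, φ u := by
        simp only [add_mul, mul_assoc]
        rw [MeasureTheory.integral_add (h_int.const_mul m) (h_int'.const_mul r),
          MeasureTheory.integral_const_mul, MeasureTheory.integral_const_mul, hodd]
        ring

/-- For every `c > 0` there is `R₀ > 0` such that for all `R ≥ R₀` and `t > 0` there is a
smooth function `k` which is nonpositive on `[0, t²R²]`, vanishes on `[0, t²R²/4]` and near
`t²R²`, has integral `−t⁴` over `[0, t²R²]`, satisfies `k(λ) ≥ −cλ` on `[0, t²R²]`, and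
attains `k(λ*) = −cλ*` at some `λ* ∈ (t²R²/4, t²R²)`. -/
theorem statement14 (c : ℝ) (hc : 0 < c) :
    ∃ R₀ : ℝ, 0 < R₀ ∧ ∀ R : ℝ, R₀ ≤ R → ∀ t : ℝ, 0 < t →
      ∃ k : ℝ → ℝ, ContDiff ℝ (⊤ : ℕ∞) k ∧
        (∀ x ∈ Set.Icc (0 : ℝ) (t ^ 2 * R ^ 2), k x ≤ 0) ∧
        (∀ x ∈ Set.Icc (0 : ℝ) (t ^ 2 * R ^ 2 / 4), k x = 0) ∧
        (∃ δ : ℝ, 0 < δ ∧ ∀ x ∈ Set.Icc (t ^ 2 * R ^ 2 - δ) (t ^ 2 * R ^ 2), k x = 0) ∧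
        (∫ x in (0 : ℝ)..(t ^ 2 * R ^ 2), k x) = -t ^ 4 ∧
        (∀ x ∈ Set.Icc (0 : ℝ) (t ^ 2 * R ^ 2), -c * x ≤ k x) ∧
        (∃ x ∈ Set.Ioo (t ^ 2 * R ^ 2 / 4) (t ^ 2 * R ^ 2), k x = -c * x) := by
  let φ : ContDiffBump (0 : ℝ) := ⟨1, 2, one_pos, one_lt_two⟩
  obtain ⟨I, hI⟩ : ∃ I : ℝ, I = ∫ u, φ u := ⟨_, rfl⟩
  have hI0 : 0 < I := hI ▸ φ.integral_pos
  refine ⟨1 + 16 / (c * I), by positivity, fun R hR t ht ↦ ?_⟩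
  have hq : 0 < 16 / (c * I) := by positivity
  have hR1 : 1 < R := by linarith
  have hR0 : 0 < R := by linarith
  have hR4 : 16 < c * I * R ^ 4 := by
    have h : 16 / (c * I) < R ^ 4 := by
      have := le_self_pow₀ hR1.le (four_ne_zero)
      linarith
    rwa [div_lt_iff₀' (by positivity)] at h
  obtain ⟨L, hL⟩ : ∃ L, L = t ^ 2 * R ^ 2 := ⟨_, rfl⟩
  obtain ⟨r, hr⟩ : ∃ r, r = 2 * t ^ 2 / (c * R ^ 2 * I) := ⟨_, rfl⟩
  have hL0 : 0 < L := by rw [hL]; positivity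
  have hr0 : 0 < r := by rw [hr]; positivity
  have hrL : 2 * r < L / 4 := by
    rw [hr, hL, mul_div_assoc', div_lt_div_iff₀ (by positivity) (by norm_num)]
    have : 0 < t ^ 2 := by positivity
    nlinarith
  rw [← hL]
  have hzero : ∀ x, 2 * r ≤ |x - L / 2| → φ ((x - L / 2) / r) = 0 := fun x hx ↦ by
    refine φ.zero_of_le_dist ?_
    rwa [Real.dist_0_eq_abs, abs_div, abs_of_pos hr0, le_div_iff₀ hr0]
  have hleft : ∀ x, x ≤ L / 4 → φ ((x - L / 2) / r) = 0 := fun x hx ↦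
    hzero x (by rw [abs_of_nonpos] <;> linarith)
  have hright : ∀ x, 3 * L / 4 ≤ x → φ ((x - L / 2) / r) = 0 := fun x hx ↦
    hzero x (by rw [abs_of_nonneg] <;> linarith)
  refine ⟨fun x ↦ -c * (x * φ ((x - L / 2) / r)), ?_, fun x hx ↦ ?_, fun x hx ↦ ?_,
    ⟨L / 4, by positivity, fun x hx ↦ ?_⟩, ?_, fun x hx ↦ ?_,
    L / 2, ⟨by linarith, by linarith⟩, ?_⟩
  · exact contDiff_const.mul (contDiff_id.mul
      (φ.contDiff.comp ((contDiff_id.sub contDiff_const).div_const r)))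
  · simp only [neg_mul, neg_nonpos]
    exact mul_nonneg hc.le (mul_nonneg hx.1 φ.nonneg)
  · simp [hleft x hx.2]
  · simp [hright x (by linarith [hx.1])]
  · rw [intervalIntegral.integral_eq_integral_of_support_subset, MeasureTheory.integral_const_mul,
      integral_mul_even_comp_sub_div φ.continuous φ.hasCompactSupport φ.neg _ hr0, ← hI, hr, hL]
    · field_simp
    · intro x hx
      by_contra h
      refine hx ?_
      rcases le_or_gt x 0 with h0 | h0
      · simp [hleft x (by linarith)]
      · have : L < x := not_le.1 fun h1 ↦ h ⟨h0, h1⟩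
        simp [hright x (by linarith)]
  · simp only [neg_mul, neg_le_neg_iff]
    exact mul_le_mul_of_nonneg_left (mul_le_of_le_one_right hx.1 φ.le_one) hc.le
  · have : φ 0 = 1 := φ.one_of_mem_closedBall (by simp [φ.rIn_pos.le])
    simp [this]
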